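/- Functional representation lemma: Let U and V be random variables on standard Borel spaces 𝒳 and 𝒴 with a given joint law μ on 𝒳 × 𝒴. Then there exist a probability space, random variables U' : Ω' → 𝒳 and W : Ω' → [0,1], and a measurable function σ : 𝒳 × [0,1] → 𝒴 such that W is uniformly distributed on [0,1], W is independent of U', and the joint law of (U', σ(U', W)) equals μ. -/

import Mathlib

open MeasureTheory ProbabilityTheory

/-- The pushforward of `μ.prod ν` under `(x, u) ↦ (x, f x u)` is the composition-product of `μ`
with any kernel whose value at `x` is the pushforward of `ν` under `f x`. -/
lemma MeasureTheory.Measure.map_prodMk_uncurry_eq_compProd {X Y Z : Type*} [MeasurableSpace X]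
    [MeasurableSpace Y] [MeasurableSpace Z] (μ : Measure X) [SFinite μ] (ν : Measure Z) [SFinite ν]
    (κ : Kernel X Y) [IsSFiniteKernel κ] {f : X → Z → Y} (hf : Measurable (Function.uncurry f))
    (hκ : ∀ x, ν.map (f x) = κ x) :
    (μ.prod ν).map (fun p => (p.1, f p.1 p.2)) = μ ⊗ₘ κ := by
  have hmeas : Measurable (fun p : X × Z => (p.1, f p.1 p.2)) := measurable_fst.prodMk hf
  ext s hs
  rw [Measure.map_apply hmeas hs, Measure.prod_apply (hmeas hs), Measure.compProd_apply hs]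
  refine lintegral_congr fun x => ?_
  rw [← hκ x, Measure.map_apply hf.of_uncurry_left (measurable_prodMk_left hs)]
  rfl

/-- **Functional representation lemma.** Given a joint law `μ` of a pair of random variables
with values in standard Borel spaces `𝒳` and `𝒴`, there exist a probability space `Ω'`,
random variables `U' : Ω' → 𝒳` and `W : Ω' → ℝ`, and a measurable function
`σ : 𝒳 × ℝ → 𝒴` such that `W` is uniformly distributed on `[0,1]` (its law is Lebesgue
measure restricted to `[0,1]`), `W` is independent of `U'`, and the joint law of
`(U', σ(U', W))` is `μ`. -/
theorem functional_representation_lemma {𝒳 𝒴 : Type*}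
    [MeasurableSpace 𝒳] [StandardBorelSpace 𝒳]
    [MeasurableSpace 𝒴] [StandardBorelSpace 𝒴]
    (μ : Measure (𝒳 × 𝒴)) [IsProbabilityMeasure μ] :
    ∃ (Ω' : Type) (_ : MeasurableSpace Ω') (P : Measure Ω')
      (U' : Ω' → 𝒳) (W : Ω' → ℝ) (σ : 𝒳 × ℝ → 𝒴),
      IsProbabilityMeasure P ∧
      Measurable U' ∧ Measurable W ∧ Measurable σ ∧
      P.map W = volume.restrict (Set.Icc (0 : ℝ) 1) ∧
      IndepFun U' W P ∧
      P.map (fun ω => (U' ω, σ (U' ω, W ω))) = μ := by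
  obtain ⟨x, y⟩ : Nonempty (𝒳 × 𝒴) := nonempty_of_isProbabilityMeasure μ
  have : Nonempty 𝒳 := ⟨x⟩
  have : Nonempty 𝒴 := ⟨y⟩
  obtain ⟨g, hg, hgμ⟩ := μ.fst.exists_measurable_map_eq
  obtain ⟨f, hf, hfκ⟩ := μ.condKernel.exists_measurable_map_eq_unitInterval
  have hproj : Measurable (Set.projIcc (0 : ℝ) 1 zero_le_one) := continuous_projIcc.measurable
  refine ⟨unitInterval × unitInterval, inferInstance, volume.prod volume, fun p => g p.1,
    fun p => (p.2 : ℝ), fun q => f q.1 (Set.projIcc 0 1 zero_le_one q.2), inferInstance,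
    hg.comp measurable_fst, measurable_subtype_coe.comp measurable_snd,
    hf.comp (measurable_fst.prodMk (hproj.comp measurable_snd)), ?_,
    indepFun_prod hg measurable_subtype_coe, ?_⟩
  · change Measure.map (Subtype.val ∘ Prod.snd) _ = _
    rw [← Measure.map_map measurable_subtype_coe measurable_snd, Measure.map_snd_prod,
      measure_univ, one_smul]
    exact map_comap_subtype_coe measurableSet_Icc volume
  · simp only [Set.projIcc_val]
    have hlaw : (volume.prod volume).map (Prod.map g id) =
        μ.fst.prod (volume : Measure unitInterval) := by
      rw [← Measure.map_prod_map _ _ hg measurable_id, hgμ, Measure.map_id]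
    rw [← μ.disintegrate μ.condKernel,
      ← Measure.map_prodMk_uncurry_eq_compProd μ.fst volume μ.condKernel hf hfκ, ← hlaw]
    exact (Measure.map_map (measurable_fst.prodMk hf) (hg.prodMap measurable_id)).symm
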